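/- arXiv:2412.17658 — 2 statements merged into one kernel-verified Lean document; each statement's English description precedes it below -/
import Mathlib

section
/- (Extended Strong Functional Representation Lemma) Let S and Z be random variables on finite alphabets with joint distribution P_{S,Z}, H(S) > 0, and let ε satisfy 0 ≤ ε ≤ H(S); set α = ε/H(S). Then there exists a random variable U, jointly distributed with (S,Z), such that I(U;S) = ε, H(Z|S,U) = 0, and I(U;S|Z) ≤ α·H(S|Z) + (1−α)·(log(I(S;Z) + 1) + 4). -/
open MeasureTheory ProbabilityTheory

/-- Shannon entropy (natural logarithm) of a random variable `X`
taking values in a finite alphabet `α`. -/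
noncomputable def infH {Ω : Type*} [MeasurableSpace Ω] {α : Type*} [Fintype α]
    (P : Measure Ω) (X : Ω → α) : ℝ :=
  ∑ a : α, Real.negMulLog (P (X ⁻¹' {a})).toReal

/-- Conditional Shannon entropy `H(X | Y)`. -/
noncomputable def infCondH {Ω : Type*} [MeasurableSpace Ω] {α β : Type*} [Fintype α] [Fintype β]
    (P : Measure Ω) (X : Ω → α) (Y : Ω → β) : ℝ :=
  infH P (fun ω => (X ω, Y ω)) - infH P Y

/-- Mutual information `I(X ; Y)`. -/
noncomputable def infMI {Ω : Type*} [MeasurableSpace Ω] {α β : Type*} [Fintype α] [Fintype β]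
    (P : Measure Ω) (X : Ω → α) (Y : Ω → β) : ℝ :=
  infH P X + infH P Y - infH P (fun ω => (X ω, Y ω))

/-- Conditional mutual information `I(X ; Y | Z)`. -/
noncomputable def infCMI {Ω : Type*} [MeasurableSpace Ω] {α β γ : Type*}
    [Fintype α] [Fintype β] [Fintype γ]
    (P : Measure Ω) (X : Ω → α) (Y : Ω → β) (Z : Ω → γ) : ℝ :=
  infCondH P X Z + infCondH P Y Z - infCondH P (fun ω => (X ω, Y ω)) Z

instance isProbabilityMeasure_expMeasure_one : IsProbabilityMeasure (expMeasure 1) :=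
  isProbabilityMeasure_expMeasure one_pos

lemma lintegral_expMeasure_one (h : ℝ → ENNReal) (hh : Measurable h) :
    ∫⁻ t, h t ∂(expMeasure 1) = ∫⁻ t in Set.Ioi 0, ENNReal.ofReal (Real.exp (-t)) * h t := by
  have h1 : expMeasure 1 = volume.withDensity (exponentialPDF 1) := rfl
  have hm : Measurable (exponentialPDF 1) := (measurable_exponentialPDFReal 1).ennreal_ofReal
  rw [h1, lintegral_withDensity_eq_lintegral_mul _ hm hh, ← lintegral_indicator measurableSet_Ioi]
  refine lintegral_congr_ae ?_
  filter_upwards [Measure.ae_ne volume (0 : ℝ)] with t ht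
  rcases lt_or_gt_of_ne ht with h0 | h0
  · simp [exponentialPDF_of_neg h0, h0.le]
  · simp [exponentialPDF_of_nonneg h0.le, h0]

lemma expMeasure_one_Ici {c : ℝ} (hc : 0 ≤ c) :
    expMeasure 1 (Set.Ici c) = ENNReal.ofReal (Real.exp (-c)) := by
  have hint : IntegrableOn (fun t : ℝ => Real.exp (-t)) (Set.Ioi c) := by
    simpa using exp_neg_integrableOn_Ioi c one_pos
  rw [← lintegral_indicator_one measurableSet_Ici,
    lintegral_expMeasure_one _ (measurable_one.indicator measurableSet_Ici)]
  have : ∀ t : ℝ, ENNReal.ofReal (Real.exp (-t)) * (Set.Ici c).indicator 1 t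
      = (Set.Ici c).indicator (fun t => ENNReal.ofReal (Real.exp (-t))) t := by
    intro t
    by_cases ht : t ∈ Set.Ici c <;> simp [ht]
  simp_rw [this]
  rw [lintegral_indicator measurableSet_Ici, Measure.restrict_restrict measurableSet_Ici]
  have hae : (Set.Ici c ∩ Set.Ioi (0 : ℝ) : Set ℝ) =ᵐ[volume] Set.Ioi c := by
    have : (Set.Ici c ∩ Set.Ioi (0 : ℝ) : Set ℝ) =ᵐ[volume] (Set.Ioi c ∩ Set.Ioi 0 : Set ℝ) :=
      Ioi_ae_eq_Ici.symm.inter (by rfl)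
    rwa [Set.Ioi_inter_Ioi, sup_eq_left.2 hc] at this
  rw [Measure.restrict_congr_set hae,
    ← ofReal_integral_eq_lintegral_ofReal hint (by filter_upwards with t using (Real.exp_pos _).le),
    integral_exp_neg_Ioi]

lemma ae_expMeasure_one_nonneg : ∀ᵐ t ∂(expMeasure 1), 0 ≤ t := by
  have h := expMeasure_one_Ici le_rfl
  simp only [neg_zero, Real.exp_zero, ENNReal.ofReal_one] at h
  exact (mem_ae_iff_prob_eq_one measurableSet_Ici).2 h

section Race

variable {ζ : Type*}

/-- The set of arrival times for which `z` wins the race in which `z'` runs at speed `q z'`. -/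
def raceCell (q : ζ → ℝ) (z : ζ) : Set (ζ → ℝ) :=
  {x | 0 < q z ∧ ∀ z', x z * q z' ≤ x z' * q z}

lemma raceCell_eq_empty {q : ζ → ℝ} {z : ζ} (hz : q z = 0) : raceCell q z = ∅ := by
  ext x; simp [raceCell, hz]

variable [Fintype ζ]

lemma measurableSet_raceCell (q : ζ → ℝ) (z : ζ) : MeasurableSet (raceCell q z) := by
  have : raceCell q z = {x | 0 < q z} ∩ ⋂ z', {x | x z * q z' ≤ x z' * q z} := by
    ext x; simp [raceCell]
  rw [this]
  refine (MeasurableSet.const _).inter (MeasurableSet.iInter fun z' => ?_)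
  exact measurableSet_le (by fun_prop) (by fun_prop)

lemma setLIntegral_raceCell {q : ζ → ℝ} (hq : ∀ z, 0 ≤ q z) (hq1 : ∑ z, q z = 1) {z : ζ}
    (hz : 0 < q z) (h : ℝ → ENNReal) (hh : Measurable h) :
    ∫⁻ x in raceCell q z, h (x z) ∂(Measure.pi fun _ : ζ => expMeasure 1)
      = ∫⁻ t in Set.Ioi 0, ENNReal.ofReal (Real.exp (-((q z)⁻¹ * t))) * h t := by
  classical
  rw [← lintegral_indicator (measurableSet_raceCell q z)]
  set A : Set (({i : ζ // i = z} → ℝ) × ({i : ζ // ¬ i = z} → ℝ)) :=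
    {p | ∀ i : {i : ζ // ¬ i = z}, p.1 ⟨z, rfl⟩ * q i ≤ p.2 i * q z} with hA
  have hAm : MeasurableSet A := by
    have : A = ⋂ i : {i : ζ // ¬ i = z}, {p | p.1 ⟨z, rfl⟩ * q i ≤ p.2 i * q z} := by ext; simp [hA]
    rw [this]
    exact MeasurableSet.iInter fun i => measurableSet_le (by fun_prop) (by fun_prop)
  have hFm : Measurable (A.indicator fun p => h (p.1 ⟨z, rfl⟩)) :=
    (hh.comp (by fun_prop)).indicator hAm
  have hind : ∀ x : ζ → ℝ, (raceCell q z).indicator (fun x => h (x z)) x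
      = A.indicator (fun p => h (p.1 ⟨z, rfl⟩))
        (MeasurableEquiv.piEquivPiSubtypeProd (fun _ : ζ => ℝ) (fun i => i = z) x) := by
    intro x
    have hiff : x ∈ raceCell q z ↔
        MeasurableEquiv.piEquivPiSubtypeProd (fun _ : ζ => ℝ) (fun i => i = z) x ∈ A := by
      simp only [raceCell, Set.mem_ofPred_eq, hz, true_and, hA]
      constructor
      · exact fun H i => H i
      · intro H i
        by_cases hi : i = z
        · rw [hi]
        · exact H ⟨i, hi⟩
    by_cases hx : x ∈ raceCell q z
    · rw [Set.indicator_of_mem hx, Set.indicator_of_mem (hiff.1 hx)]; rfl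
    · rw [Set.indicator_of_notMem hx, Set.indicator_of_notMem (fun H => hx (hiff.2 H))]
  simp_rw [hind]
  rw [(measurePreserving_piEquivPiSubtypeProd (fun _ : ζ => expMeasure 1)
    (fun i => i = z)).lintegral_comp hFm, lintegral_prod _ hFm.aemeasurable]
  have hinner : ∀ u : {i : ζ // i = z} → ℝ,
      ∫⁻ v, A.indicator (fun p => h (p.1 ⟨z, rfl⟩)) (u, v) ∂(Measure.pi fun _ => expMeasure 1)
      = (fun t : ℝ => h t * ∏ i : {i : ζ // ¬ i = z}, expMeasure 1 (Set.Ici (t * q i / q z)))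
        (u ⟨z, rfl⟩) := by
    intro u
    have hset : (Prod.mk u ⁻¹' A : Set ({i : ζ // ¬ i = z} → ℝ))
        = Set.univ.pi fun i : {i : ζ // ¬ i = z} => Set.Ici (u ⟨z, rfl⟩ * q i / q z) := by
      ext v
      simp [hA, Pi.le_def, div_le_iff₀ hz]
    have : ∀ v, A.indicator (fun p => h (p.1 ⟨z, rfl⟩)) (u, v)
        = (Prod.mk u ⁻¹' A).indicator (fun _ => h (u ⟨z, rfl⟩)) v := by
      intro v
      by_cases hv : (u, v) ∈ A <;> simp [hv]
    simp_rw [this]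
    rw [lintegral_indicator_const (measurable_prodMk_left hAm), hset, Measure.pi_pi]
  simp_rw [hinner]
  have hmeasg : Measurable (fun t : ℝ => h t *
      ∏ i : {i : ζ // ¬ i = z}, expMeasure 1 (Set.Ici (t * q i / q z))) := by
    refine hh.mul (Finset.measurable_prod _ fun i _ => ?_)
    have : Antitone fun c : ℝ => expMeasure 1 (Set.Ici c) :=
      fun a b hab => measure_mono (Set.Ici_subset_Ici.2 hab)
    exact this.measurable.comp (by fun_prop)
  have heval := (measurePreserving_eval (fun _ : {i : ζ // i = z} => expMeasure 1)
    ⟨z, rfl⟩).lintegral_comp hmeasg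
  simp only [Function.eval] at heval
  refine Eq.trans ?_ (heval.trans ?_)
  · convert rfl
  rw [lintegral_expMeasure_one _ hmeasg]
  refine setLIntegral_congr_fun measurableSet_Ioi fun t ht => ?_
  have ht0 : 0 < t := ht
  have h1 : ∀ i : {i : ζ // ¬ i = z}, expMeasure 1 (Set.Ici (t * q i / q z))
      = ENNReal.ofReal (Real.exp (-(t * q i / q z))) := fun i =>
    expMeasure_one_Ici (div_nonneg (mul_nonneg ht0.le (hq _)) hz.le)
  have h2 : ∑ i : {i : ζ // ¬ i = z}, q i = 1 - q z := by
    rw [← Finset.sum_subtype (Finset.univ.erase z) (by simp) q,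
      Finset.sum_erase_eq_sub (Finset.mem_univ z), hq1]
  simp only [h1]
  rw [← ENNReal.ofReal_prod_of_nonneg (fun _ _ => (Real.exp_pos _).le), ← Real.exp_sum,
    mul_left_comm, ← ENNReal.ofReal_mul (Real.exp_pos _).le, ← Real.exp_add, mul_comm]
  congr 3
  rw [Finset.sum_neg_distrib, ← Finset.sum_div, ← Finset.mul_sum, h2]
  field_simp
  ring

/-- The joint law of independent standard exponential arrival times. -/
noncomputable def raceMeasure (ζ : Type*) [Fintype ζ] : Measure (ζ → ℝ) :=
  Measure.pi fun _ : ζ => expMeasure 1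

instance isProbabilityMeasure_raceMeasure : IsProbabilityMeasure (raceMeasure ζ) := by
  unfold raceMeasure; infer_instance

lemma ae_raceMeasure_nonneg : ∀ᵐ x ∂(raceMeasure ζ), ∀ z, 0 ≤ x z :=
  ae_all_iff.2 fun z => (measurePreserving_eval (fun _ : ζ => expMeasure 1)
    z).quasiMeasurePreserving.ae ae_expMeasure_one_nonneg

lemma raceMeasure_real_raceCell {q : ζ → ℝ} (hq : ∀ z, 0 ≤ q z) (hq1 : ∑ z, q z = 1) (z : ζ) :
    (raceMeasure ζ).real (raceCell q z) = q z := by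
  rcases (hq z).eq_or_lt with h0 | h0
  · simp [raceCell_eq_empty h0.symm, ← h0]
  have hr : 0 < (q z)⁻¹ := inv_pos.2 h0
  have h := setLIntegral_raceCell hq hq1 h0 (fun _ => 1) measurable_const
  have hi := Real.integral_rpow_mul_exp_neg_mul_Ioi one_pos hr
  simp only [sub_self, Real.rpow_zero, one_mul, one_div, inv_inv, Real.rpow_one, Real.Gamma_one,
    mul_one] at hi
  have hint := Integrable.of_integral_ne_zero (hi.trans_ne h0.ne')
  simp only [lintegral_const, one_mul, Measure.restrict_apply_univ, mul_one] at h
  rw [← ofReal_integral_eq_lintegral_ofReal hint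
    (by filter_upwards with t using (Real.exp_pos _).le), hi] at h
  rw [measureReal_def, raceMeasure, h, ENNReal.toReal_ofReal h0.le]

lemma integrableOn_raceCell {q : ζ → ℝ} (hq : ∀ z, 0 ≤ q z) (hq1 : ∑ z, q z = 1) (z : ζ) :
    IntegrableOn (fun x : ζ → ℝ => x z) (raceCell q z) (raceMeasure ζ) ∧
      ∫ x in raceCell q z, x z ∂(raceMeasure ζ) = q z ^ 2 := by
  rcases (hq z).eq_or_lt with h0 | h0
  · simp [raceCell_eq_empty h0.symm, ← h0]
  have hr : 0 < (q z)⁻¹ := inv_pos.2 h0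
  have h := setLIntegral_raceCell hq hq1 h0 ENNReal.ofReal ENNReal.measurable_ofReal
  have hi := Real.integral_rpow_mul_exp_neg_mul_Ioi two_pos hr
  have h21 : (2 : ℝ) - 1 = 1 := by norm_num
  simp only [h21, one_div, inv_inv, Real.rpow_one, Real.Gamma_two, Real.rpow_two, mul_one] at hi
  have hint := Integrable.of_integral_ne_zero (hi.trans_ne (pow_pos h0 2).ne')
  have h2 : ∀ t : ℝ, ENNReal.ofReal (Real.exp (-((q z)⁻¹ * t))) * ENNReal.ofReal t
      = ENNReal.ofReal (t * Real.exp (-((q z)⁻¹ * t))) := by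
    intro t
    rw [← ENNReal.ofReal_mul (Real.exp_pos _).le, mul_comm]
  simp_rw [h2] at h
  rw [← ofReal_integral_eq_lintegral_ofReal hint
    (by filter_upwards [ae_restrict_mem measurableSet_Ioi] with t ht using
      mul_nonneg (le_of_lt ht) (Real.exp_pos _).le), hi] at h
  have hnn : 0 ≤ᵐ[(raceMeasure ζ).restrict (raceCell q z)] fun x => x z :=
    ae_restrict_of_ae (ae_raceMeasure_nonneg.mono fun x hx => hx z)
  have hms : AEStronglyMeasurable (fun x : ζ → ℝ => x z)
    ((raceMeasure ζ).restrict (raceCell q z)) := (measurable_pi_apply z).aestronglyMeasurable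
  refine ⟨⟨hms, ?_⟩, ?_⟩
  · rw [hasFiniteIntegral_iff_ofReal hnn, raceMeasure, h]
    exact ENNReal.ofReal_lt_top
  · rw [integral_eq_lintegral_of_nonneg_ae hnn hms, raceMeasure, h,
      ENNReal.toReal_ofReal (sq_nonneg _)]

lemma exists_mem_raceCell {q : ζ → ℝ} (hq : ∀ z, 0 ≤ q z) (hq1 : ∑ z, q z = 1)
    {x : ζ → ℝ} (hx : ∀ z, 0 ≤ x z) : ∃ z, x ∈ raceCell q z := by
  have hne : (Finset.univ.filter fun z => 0 < q z).Nonempty := by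
    by_contra h
    rw [Finset.not_nonempty_iff_eq_empty, Finset.filter_eq_empty_iff] at h
    have : ∑ z, q z = 0 := Finset.sum_eq_zero fun z _ =>
      le_antisymm (not_lt.1 (h (Finset.mem_univ z))) (hq z)
    linarith
  obtain ⟨z, hz, hmin⟩ := Finset.exists_min_image _ (fun z => x z / q z) hne
  simp only [Finset.mem_filter, Finset.mem_univ, true_and] at hz hmin
  refine ⟨z, hz, fun z' => ?_⟩
  rcases (hq z').eq_or_lt with h0 | h0
  · rw [← h0, mul_zero]
    exact mul_nonneg (hx z') hz.le
  · exact (div_le_div_iff₀ hz h0).1 (hmin z' h0)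

lemma ae_sum_indicator_raceCell {q : ζ → ℝ} (hq : ∀ z, 0 ≤ q z) (hq1 : ∑ z, q z = 1) :
    ∀ᵐ x ∂(raceMeasure ζ), ∑ z, (raceCell q z).indicator (1 : (ζ → ℝ) → ℝ) x = 1 := by
  have hint : ∀ z, Integrable ((raceCell q z).indicator (1 : (ζ → ℝ) → ℝ)) (raceMeasure ζ) :=
    fun z => (integrable_const (1 : ℝ)).indicator (measurableSet_raceCell q z)
  have hsum : Integrable (fun x => ∑ z, (raceCell q z).indicator (1 : (ζ → ℝ) → ℝ) x - 1)
      (raceMeasure ζ) := (integrable_finsetSum _ fun z _ => hint z).sub (integrable_const 1)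
  have hnn : 0 ≤ᵐ[raceMeasure ζ]
      fun x => ∑ z, (raceCell q z).indicator (1 : (ζ → ℝ) → ℝ) x - 1 := by
    filter_upwards [ae_raceMeasure_nonneg] with x hx
    obtain ⟨z, hz⟩ := exists_mem_raceCell hq hq1 hx
    have := Finset.single_le_sum (f := fun z => (raceCell q z).indicator (1 : (ζ → ℝ) → ℝ) x)
      (fun z _ => Set.indicator_nonneg (fun _ _ => zero_le_one) x) (Finset.mem_univ z)
    simp only [Set.indicator_of_mem hz, Pi.one_apply] at this
    simpa using this
  have hzero : ∫ x, (∑ z, (raceCell q z).indicator (1 : (ζ → ℝ) → ℝ) x - 1) ∂(raceMeasure ζ)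
      = 0 := by
    rw [integral_sub (integrable_finsetSum _ fun z _ => hint z) (integrable_const 1),
      integral_finsetSum _ fun z _ => hint z]
    simp_rw [integral_indicator_one (measurableSet_raceCell q _), raceMeasure_real_raceCell hq hq1]
    simp [hq1]
  filter_upwards [(integral_eq_zero_iff_of_nonneg_ae hnn hsum).1 hzero] with x hx
  simpa [sub_eq_zero] using hx

lemma lintegral_pareto {δ p : ℝ} (hδ : 0 < δ) (hp : 0 < p) :
    ∫⁻ t in Set.Ioi 0, ENNReal.ofReal (δ * (1 + t / p) ^ (-δ - 1)) = ENNReal.ofReal p := by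
  have hderiv : ∀ t ∈ Set.Ici (0 : ℝ),
      HasDerivAt (fun t => -p * (1 + t / p) ^ (-δ)) (δ * (1 + t / p) ^ (-δ - 1)) t := by
    intro t ht
    have ht0 : 0 ≤ t := ht
    have h1 : HasDerivAt (fun t => 1 + t / p) (1 / p) t :=
      ((hasDerivAt_id t).div_const p).const_add 1
    have h2 := (h1.rpow_const (p := -δ) (Or.inl (by positivity))).const_mul (-p)
    refine h2.congr_deriv ?_
    field_simp
  have hpos : ∀ t ∈ Set.Ioi (0 : ℝ), 0 ≤ δ * (1 + t / p) ^ (-δ - 1) := by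
    intro t ht
    have ht0 : 0 < t := ht
    positivity
  have hlim : Filter.Tendsto (fun t => -p * (1 + t / p) ^ (-δ)) Filter.atTop (nhds 0) := by
    have h1 : Filter.Tendsto (fun t : ℝ => 1 + t / p) Filter.atTop Filter.atTop :=
      Filter.tendsto_atTop_add_const_left _ _ (Filter.tendsto_id.atTop_div_const hp)
    simpa using ((tendsto_rpow_neg_atTop hδ).comp h1).const_mul (-p)
  rw [← ofReal_integral_eq_lintegral_ofReal (integrableOn_Ioi_deriv_of_nonneg' hderiv hpos hlim)
    (by filter_upwards [ae_restrict_mem measurableSet_Ioi] with t ht using hpos t ht),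
    integral_Ioi_of_hasDerivAt_of_nonneg' hderiv hpos hlim]
  simp

lemma integral_pareto_raceMeasure_le {δ p : ℝ} (hδ : 0 < δ) (hp : 0 < p) (z : ζ) :
    Integrable (fun x : ζ → ℝ => δ * (1 + x z / p) ^ (-δ - 1)) (raceMeasure ζ) ∧
      ∫ x, δ * (1 + x z / p) ^ (-δ - 1) ∂(raceMeasure ζ) ≤ p := by
  have hm : Measurable fun t : ℝ => δ * (1 + t / p) ^ (-δ - 1) := by fun_prop
  have hle : ∫⁻ x, ENNReal.ofReal (δ * (1 + x z / p) ^ (-δ - 1)) ∂(raceMeasure ζ)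
      ≤ ENNReal.ofReal p := by
    have := (measurePreserving_eval (fun _ : ζ => expMeasure 1) z).lintegral_comp
      hm.ennreal_ofReal
    simp only [Function.eval] at this
    rw [raceMeasure, this, lintegral_expMeasure_one _ hm.ennreal_ofReal, ← lintegral_pareto hδ hp]
    refine setLIntegral_mono' measurableSet_Ioi fun t ht => mul_le_of_le_one_left' ?_
    rw [← ENNReal.ofReal_one]
    exact ENNReal.ofReal_le_ofReal (Real.exp_le_one_iff.2 (neg_nonpos.2 (le_of_lt ht)))
  have hnn : 0 ≤ᵐ[raceMeasure ζ] fun x => δ * (1 + x z / p) ^ (-δ - 1) := by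
    filter_upwards [ae_raceMeasure_nonneg] with x hx
    have := hx z
    simp only [Pi.zero_apply]
    positivity
  have hms : AEStronglyMeasurable (fun x : ζ → ℝ => δ * (1 + x z / p) ^ (-δ - 1))
      (raceMeasure ζ) := (hm.comp (measurable_pi_apply z)).aestronglyMeasurable
  refine ⟨⟨hms, ?_⟩, ?_⟩
  · rw [hasFiniteIntegral_iff_ofReal hnn]
    exact hle.trans_lt ENNReal.ofReal_lt_top
  · rw [integral_eq_lintegral_of_nonneg_ae hnn hms]
    exact ENNReal.toReal_le_of_le_ofReal hp.le hle

end Race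

section FunctionalRepresentation

variable {σ ζ : Type*} [Fintype σ] [Fintype ζ]

lemma sum_prod_apply_mul [DecidableEq σ] {b : σ → ζ → ℝ} (hb : ∀ s, ∑ z, b s z = 1) (s₀ : σ)
    (c : ζ → ℝ) : ∑ f : σ → ζ, (∏ s, b s (f s)) * c (f s₀) = ∑ z, b s₀ z * c z := by
  have h := Finset.prod_univ_sum (fun _ : σ => (Finset.univ : Finset ζ))
    (fun s z => b s z * if s = s₀ then c z else 1)
  rw [Fintype.piFinset_univ] at h
  rw [← Finset.mul_prod_erase _ _ (Finset.mem_univ s₀)] at h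
  rw [Finset.prod_eq_one (s := Finset.univ.erase s₀)] at h
  · simp only [if_true, mul_one] at h
    rw [h]
    refine Finset.sum_congr rfl fun f _ => ?_
    rw [Finset.prod_mul_distrib, Finset.prod_ite_eq' Finset.univ s₀ (fun s => c (f s))]
    simp
  · intro s hs
    simp [Finset.ne_of_mem_erase hs, hb]

lemma sum_prod_apply [DecidableEq σ] {b : σ → ζ → ℝ} (hb : ∀ s, ∑ z, b s z = 1) :
    ∑ f : σ → ζ, ∏ s, b s (f s) = 1 := by
  have h := Finset.prod_univ_sum (fun _ : σ => (Finset.univ : Finset ζ)) b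
  rw [Fintype.piFinset_univ] at h
  rw [← h]
  simp [hb]

lemma negMulLog_le_cross {p g : ℝ} (hp : 0 ≤ p) (hg : 0 ≤ g) (hpg : 0 < p → 0 < g) :
    Real.negMulLog p ≤ p * (-Real.log g) + g - p := by
  rcases hp.eq_or_lt with h0 | h0
  · simpa [← h0] using hg
  have hg0 := hpg h0
  have h := Real.log_le_sub_one_of_pos (div_pos hg0 h0)
  rw [Real.log_div hg0.ne' h0.ne'] at h
  have h2 := mul_le_mul_of_nonneg_left h h0.le
  have h3 : p * (g / p - 1) = g - p := by field_simp
  rw [h3] at h2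
  rw [Real.negMulLog]
  linarith

lemma sum_negMulLog_le_cross [DecidableEq ζ] {P : σ → ℝ} (hP : ∀ s, 0 ≤ P s) (hP1 : ∑ s, P s = 1)
    (f : σ → ζ) {g : ζ → ℝ} (hg : ∀ z, 0 ≤ g z) (hgf : ∀ s, 0 < P s → 0 < g (f s)) :
    ∑ z, Real.negMulLog (∑ s, if f s = z then P s else 0)
      ≤ ∑ s, P s * (-Real.log (g (f s))) + ∑ z, g z - 1 := by
  have hnn : ∀ z, ∀ s ∈ (Finset.univ : Finset σ), 0 ≤ if f s = z then P s else 0 := by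
    intro z s _
    split_ifs
    exacts [hP s, le_rfl]
  calc ∑ z, Real.negMulLog (∑ s, if f s = z then P s else 0)
      ≤ ∑ z, ((∑ s, if f s = z then P s else 0) * (-Real.log (g z)) + g z
          - ∑ s, if f s = z then P s else 0) := by
        refine Finset.sum_le_sum fun z _ => negMulLog_le_cross (Finset.sum_nonneg (hnn z)) (hg z) ?_
        intro hpos
        obtain ⟨s, _, hs⟩ := Finset.exists_ne_zero_of_sum_ne_zero hpos.ne'
        have hfs : f s = z := by
          by_contra h
          simp [h] at hs
        rw [if_pos hfs] at hs
        exact hfs ▸ hgf s ((hP s).lt_of_ne' hs)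
    _ = _ := by
        rw [Finset.sum_sub_distrib, Finset.sum_add_distrib]
        congr 1
        · congr 1
          simp_rw [Finset.sum_mul]
          rw [Finset.sum_comm]
          refine Finset.sum_congr rfl fun s _ => ?_
          simp [ite_mul]
        · rw [Finset.sum_comm, ← hP1]
          simp

lemma log_one_add_le_tangent {y r : ℝ} (hy : 0 ≤ y) (hr : 0 ≤ r) :
    Real.log (1 + y) ≤ Real.log (1 + r) - r / (1 + r) + y / (1 + r) := by
  have hr1 : 0 < 1 + r := by linarith
  have hy1 : 0 < 1 + y := by linarith
  have h := Real.log_le_sub_one_of_pos (div_pos hy1 hr1)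
  rw [Real.log_div hy1.ne' hr1.ne'] at h
  have : (1 + y) / (1 + r) - 1 = y / (1 + r) - r / (1 + r) := by field_simp; ring
  linarith

/-- Coupling the channels `q s` by exponential races: the entropy of the output given the random
function, up to the choice of the exponent `δ` of the reference density. -/
theorem exists_functional_representation_aux [DecidableEq σ] [DecidableEq ζ]
    {P : σ → ℝ} (hP : ∀ s, 0 ≤ P s) (hP1 : ∑ s, P s = 1)
    {q : σ → ζ → ℝ} (hq : ∀ s z, 0 ≤ q s z) (hq1 : ∀ s, ∑ z, q s z = 1)
    {pZ : ζ → ℝ} (hpZ : ∀ z, pZ z = ∑ s, P s * q s z) {δ : ℝ} (hδ : 0 < δ) :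
    ∃ w : (σ → ζ) → ℝ, (∀ f, 0 ≤ w f) ∧ ∑ f, w f = 1 ∧
      (∀ s z, (∑ f, if f s = z then w f else 0) = q s z) ∧
      ∑ f, w f * ∑ z, Real.negMulLog (∑ s, if f s = z then P s else 0)
        ≤ -Real.log δ + (1 + δ) * ∑ s, ∑ z, P s * q s z * Real.log (1 + q s z / pZ z) := by
  set ν := raceMeasure ζ
  set b : σ → ζ → (ζ → ℝ) → ℝ := fun s z => (raceCell (q s) z).indicator 1 with hbdef
  have hbm : ∀ s z, Measurable (b s z) := fun s z =>
    measurable_one.indicator (measurableSet_raceCell (q s) z)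
  have hb0 : ∀ s z x, 0 ≤ b s z x := fun s z x =>
    Set.indicator_nonneg (fun _ _ => zero_le_one) x
  have hb1 : ∀ s z x, b s z x ≤ 1 := fun s z x =>
    Set.indicator_le_self' (f := (1 : (ζ → ℝ) → ℝ)) (fun _ _ => zero_le_one) x
  have hbq : ∀ s z x, b s z x ≠ 0 → 0 < q s z := by
    intro s z x h
    exact (Set.mem_of_indicator_ne_zero h).1
  have hbint : ∀ s z, Integrable (b s z) ν := fun s z =>
    (integrable_const (1 : ℝ)).indicator (measurableSet_raceCell (q s) z)
  have hbI : ∀ s z, ∫ x, b s z x ∂ν = q s z := fun s z => by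
    rw [integral_indicator_one (measurableSet_raceCell _ _),
      raceMeasure_real_raceCell (hq s) (hq1 s)]
  have hbx : ∀ s z, (fun x : ζ → ℝ => b s z x * x z)
      = (raceCell (q s) z).indicator fun x => x z := by
    intro s z
    ext x
    by_cases hx : x ∈ raceCell (q s) z <;> simp [hbdef, hx]
  have hbxint : ∀ s z, Integrable (fun x : ζ → ℝ => b s z x * x z) ν := fun s z => by
    rw [hbx, integrable_indicator_iff (measurableSet_raceCell _ _)]
    exact (integrableOn_raceCell (hq s) (hq1 s) z).1
  have hbxI : ∀ s z, ∫ x, b s z x * x z ∂ν = q s z ^ 2 := fun s z => by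
    rw [hbx, integral_indicator (measurableSet_raceCell _ _)]
    exact (integrableOn_raceCell (hq s) (hq1 s) z).2
  have hae : ∀ᵐ x ∂ν, ∀ s, ∑ z, b s z x = 1 :=
    ae_all_iff.2 fun s => ae_sum_indicator_raceCell (hq s) (hq1 s)
  have hprodint : ∀ f : σ → ζ, Integrable (fun x => ∏ s, b s (f s) x) ν := by
    intro f
    refine Integrable.of_bound (Finset.measurable_prod _ fun s _ =>
      hbm s (f s)).aestronglyMeasurable 1 (Filter.Eventually.of_forall fun x => ?_)
    rw [Real.norm_of_nonneg (Finset.prod_nonneg fun s _ => hb0 s _ x)]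
    exact Finset.prod_le_one (fun s _ => hb0 s _ x) fun s _ => hb1 s _ x
  have hpZ0 : ∀ z, 0 ≤ pZ z := fun z => by
    rw [hpZ]; exact Finset.sum_nonneg fun s _ => mul_nonneg (hP s) (hq s z)
  have hpZpos : ∀ s z, 0 < P s → 0 < q s z → 0 < pZ z := fun s z h1 h2 => by
    rw [hpZ]
    exact (mul_pos h1 h2).trans_le (Finset.single_le_sum (f := fun s => P s * q s z)
      (fun s _ => mul_nonneg (hP s) (hq s z)) (Finset.mem_univ s))
  have hpZ1 : ∑ z, pZ z = 1 := by
    simp_rw [hpZ]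
    rw [Finset.sum_comm]
    simp_rw [← Finset.mul_sum, hq1, mul_one, hP1]
  set G : ζ → (ζ → ℝ) → ℝ := fun z x =>
    if pZ z = 0 then 0 else δ * (1 + x z / pZ z) ^ (-δ - 1) with hG
  have hGint : ∀ z, Integrable (G z) ν ∧ ∫ x, G z x ∂ν ≤ pZ z := by
    intro z
    by_cases hz : pZ z = 0
    · simp [hG, hz]
    · simpa [hG, hz] using integral_pareto_raceMeasure_le hδ ((hpZ0 z).lt_of_ne' hz) z
  set r : σ → ζ → ℝ := fun s z => q s z / pZ z with hr
  set c₀ : σ → ζ → ℝ := fun s z =>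
    -Real.log δ + (1 + δ) * (Real.log (1 + r s z) - r s z / (1 + r s z)) with hc₀
  set c₁ : σ → ζ → ℝ := fun s z => (1 + δ) * (1 / pZ z / (1 + r s z)) with hc₁
  set Hf : (σ → ζ) → ℝ := fun f => ∑ z, Real.negMulLog (∑ s, if f s = z then P s else 0) with hHf
  have hpoint : ∀ᵐ x ∂ν, ∑ f : σ → ζ, (∏ s, b s (f s) x) * Hf f
      ≤ ∑ s, ∑ z, P s * (c₀ s z * b s z x + c₁ s z * (b s z x * x z)) + ∑ z, G z x - 1 := by
    filter_upwards [hae, ae_raceMeasure_nonneg] with x hx hx0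
    have hGnn : ∀ z, 0 ≤ G z x := by
      intro z
      simp only [hG]
      split_ifs
      · exact le_rfl
      · have := hx0 z
        have := hpZ0 z
        positivity
    have hlog : ∀ s z, 0 < P s → 0 < q s z → 0 < G z x ∧
        -Real.log (G z x) = -Real.log δ + (1 + δ) * Real.log (1 + x z / pZ z) := by
      intro s z h1 h2
      have h3 := hpZpos s z h1 h2
      have h4 := hx0 z
      have h5 : 0 < 1 + x z / pZ z := by positivity
      have h6 := Real.rpow_pos_of_pos h5 (-δ - 1)
      simp only [hG, h3.ne', if_false]
      refine ⟨mul_pos hδ h6, ?_⟩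
      rw [Real.log_mul hδ.ne' h6.ne', Real.log_rpow h5]
      ring
    calc ∑ f : σ → ζ, (∏ s, b s (f s) x) * Hf f
        ≤ ∑ f : σ → ζ, (∏ s, b s (f s) x) *
            (∑ s, P s * (-Real.log (G (f s) x)) + (∑ z, G z x - 1)) := by
          refine Finset.sum_le_sum fun f _ => ?_
          by_cases h0 : ∏ s, b s (f s) x = 0
          · simp [h0]
          refine mul_le_mul_of_nonneg_left ?_ (Finset.prod_nonneg fun s _ => hb0 s _ x)
          rw [← add_sub_assoc]
          refine sum_negMulLog_le_cross hP hP1 f hGnn fun s hs => (hlog s _ hs ?_).1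
          exact hbq s _ x (Finset.prod_ne_zero_iff.1 h0 s (Finset.mem_univ s))
      _ = ∑ s, ∑ z, P s * (b s z x * (-Real.log (G z x))) + ∑ z, G z x - 1 := by
          simp_rw [mul_add, Finset.sum_add_distrib, ← Finset.sum_mul]
          rw [sum_prod_apply (b := fun s z => b s z x) hx, one_mul, ← add_sub_assoc]
          congr 2
          simp_rw [Finset.mul_sum]
          rw [Finset.sum_comm]
          refine Finset.sum_congr rfl fun s _ => ?_
          rw [← Finset.mul_sum, ← sum_prod_apply_mul (b := fun s z => b s z x) hx s
            (fun z => -Real.log (G z x)), Finset.mul_sum]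
          exact Finset.sum_congr rfl fun f _ => by ring
      _ ≤ _ := by
          refine sub_le_sub_right (add_le_add_left (Finset.sum_le_sum fun s _ =>
            Finset.sum_le_sum fun z _ => ?_) _) _
          rcases (hP s).eq_or_lt with h1 | h1
          · simp [← h1]
          refine mul_le_mul_of_nonneg_left ?_ h1.le
          by_cases h2 : b s z x = 0
          · simp [h2]
          have h3 := hbq s z x h2
          have h4 := hpZpos s z h1 h3
          rw [(hlog s z h1 h3).2]
          have h5 := log_one_add_le_tangent (div_nonneg (hx0 z) h4.le) (div_nonneg h3.le h4.le)
          have h6 := mul_le_mul_of_nonneg_left h5 (by positivity : 0 ≤ 1 + δ)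
          have h7 : c₀ s z * b s z x + c₁ s z * (b s z x * x z) = b s z x *
              (-Real.log δ + (1 + δ) * (Real.log (1 + q s z / pZ z)
                - q s z / pZ z / (1 + q s z / pZ z) + x z / pZ z / (1 + q s z / pZ z))) := by
            simp only [hc₀, hc₁, hr]
            ring
          rw [h7]
          exact mul_le_mul_of_nonneg_left (by linarith) (hb0 s z x)
  have hlinint : ∀ s z, Integrable
      (fun x => P s * (c₀ s z * b s z x + c₁ s z * (b s z x * x z))) ν := fun s z =>
    (((hbint s z).const_mul _).add ((hbxint s z).const_mul _)).const_mul _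
  have hlinI : ∀ s z, ∫ x, P s * (c₀ s z * b s z x + c₁ s z * (b s z x * x z)) ∂ν
      = P s * q s z * (-Real.log δ) + (1 + δ) * (P s * q s z * Real.log (1 + q s z / pZ z)) := by
    intro s z
    rw [integral_const_mul, integral_add ((hbint s z).const_mul _) ((hbxint s z).const_mul _),
      integral_const_mul, integral_const_mul, hbI, hbxI]
    rcases (hP s).eq_or_lt with h1 | h1
    · simp [← h1]
    rcases (hq s z).eq_or_lt with h2 | h2
    · simp [← h2]
    have h4 := hpZpos s z h1 h2
    simp only [hc₀, hc₁, hr]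
    have h5 : (0 : ℝ) < 1 + q s z / pZ z := by positivity
    generalize Real.log (1 + q s z / pZ z) = l
    have h6 : 1 / pZ z / (1 + q s z / pZ z) * q s z ^ 2
        = q s z * (q s z / pZ z / (1 + q s z / pZ z)) := by ring
    linear_combination P s * (1 + δ) * h6
  refine ⟨fun f => ∫ x, ∏ s, b s (f s) x ∂ν, fun f => integral_nonneg fun x =>
    Finset.prod_nonneg fun s _ => hb0 s _ x, ?_, ?_, ?_⟩
  · rw [← integral_finsetSum _ fun f _ => hprodint f, integral_congr_ae (g := fun _ => (1 : ℝ))]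
    · simp
    · filter_upwards [hae] with x hx using sum_prod_apply (b := fun s z => b s z x) hx
  · intro s z
    have h1 : ∀ f : σ → ζ, (if f s = z then ∫ x, ∏ s, b s (f s) x ∂ν else 0)
        = ∫ x, (∏ s, b s (f s) x) * (if f s = z then 1 else 0) ∂ν := by
      intro f
      split_ifs <;> simp
    simp_rw [h1]
    rw [← integral_finsetSum _ fun f _ => (hprodint f).mul_const _, ← hbI s z]
    refine integral_congr_ae ?_
    filter_upwards [hae] with x hx
    rw [sum_prod_apply_mul (b := fun s z => b s z x) hx s (fun z' => if z' = z then 1 else 0)]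
    simp
  · have hlhs : ∑ f : σ → ζ, (∫ x, ∏ s, b s (f s) x ∂ν) * Hf f
        = ∫ x, ∑ f : σ → ζ, (∏ s, b s (f s) x) * Hf f ∂ν := by
      rw [integral_finsetSum _ fun f _ => (hprodint f).mul_const _]
      simp_rw [integral_mul_const]
    rw [hlhs]
    have hi1 : Integrable (fun x => ∑ s, ∑ z,
        P s * (c₀ s z * b s z x + c₁ s z * (b s z x * x z))) ν :=
      integrable_finsetSum _ fun s _ => integrable_finsetSum _ fun z _ => hlinint s z
    have hi2 : Integrable (fun x => ∑ z, G z x) ν :=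
      integrable_finsetSum _ fun z _ => (hGint z).1
    refine (integral_mono_ae (integrable_finsetSum _ fun f _ => (hprodint f).mul_const _)
      ((hi1.add hi2).sub (integrable_const 1)) hpoint).trans ?_
    rw [integral_sub' (hi1.add hi2) (integrable_const 1), integral_add' hi1 hi2,
      integral_finsetSum _ fun s _ => integrable_finsetSum _ fun z _ => hlinint s z,
      integral_finsetSum _ fun z _ => (hGint z).1]
    have h1 : ∑ z, ∫ x, G z x ∂ν ≤ 1 := hpZ1 ▸ Finset.sum_le_sum fun z _ => (hGint z).2
    have h2 : ∑ s, ∫ x, ∑ z, P s * (c₀ s z * b s z x + c₁ s z * (b s z x * x z)) ∂ν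
        = -Real.log δ + (1 + δ) * ∑ s, ∑ z, P s * q s z * Real.log (1 + q s z / pZ z) := by
      simp_rw [integral_finsetSum _ fun z _ => hlinint _ z, hlinI, Finset.sum_add_distrib,
        ← Finset.mul_sum, ← Finset.sum_mul, ← Finset.mul_sum, hq1, mul_one, hP1, one_mul]
    rw [h2]
    simp
    linarith

theorem exists_functional_representation [DecidableEq σ] [DecidableEq ζ]
    {P : σ → ℝ} (hP : ∀ s, 0 ≤ P s) (hP1 : ∑ s, P s = 1)
    {q : σ → ζ → ℝ} (hq : ∀ s z, 0 ≤ q s z) (hq1 : ∀ s, ∑ z, q s z = 1)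
    {pZ : ζ → ℝ} (hpZ : ∀ z, pZ z = ∑ s, P s * q s z) {I : ℝ}
    (hI : I = ∑ s, ∑ z, P s * q s z * Real.log (q s z / pZ z)) :
    ∃ w : (σ → ζ) → ℝ, (∀ f, 0 ≤ w f) ∧ ∑ f, w f = 1 ∧
      (∀ s z, (∑ f, if f s = z then w f else 0) = q s z) ∧
      ∑ f, w f * ∑ z, Real.negMulLog (∑ s, if f s = z then P s else 0)
        ≤ I + Real.log (I + 1) + 2 := by
  have hpZ0 : ∀ z, 0 ≤ pZ z := fun z => by
    rw [hpZ]; exact Finset.sum_nonneg fun s _ => mul_nonneg (hP s) (hq s z)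
  have hpZpos : ∀ s z, 0 < P s → 0 < q s z → 0 < pZ z := fun s z h1 h2 => by
    rw [hpZ]
    exact (mul_pos h1 h2).trans_le (Finset.single_le_sum (f := fun s => P s * q s z)
      (fun s _ => mul_nonneg (hP s) (hq s z)) (Finset.mem_univ s))
  have hpZ1 : ∑ z, pZ z = 1 := by
    simp_rw [hpZ]
    rw [Finset.sum_comm]
    simp_rw [← Finset.mul_sum, hq1, mul_one, hP1]
  have hPp : ∑ s, ∑ z, P s * pZ z = 1 := by
    simp_rw [← Finset.mul_sum, hpZ1, mul_one, hP1]
  have hPq : ∑ s, ∑ z, P s * q s z = 1 := by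
    simp_rw [← Finset.mul_sum, hq1, mul_one, hP1]
  have hI0 : 0 ≤ I := by
    have h : ∑ s, ∑ z, (P s * q s z - P s * pZ z) ≤ I := by
      rw [hI]
      refine Finset.sum_le_sum fun s _ => Finset.sum_le_sum fun z _ => ?_
      rcases (hP s).eq_or_lt with h1 | h1
      · simp [← h1]
      rcases (hq s z).eq_or_lt with h2 | h2
      · simpa [← h2] using mul_nonneg h1.le (hpZ0 z)
      have h3 := hpZpos s z h1 h2
      have h4 := mul_le_mul_of_nonneg_left (Real.one_sub_inv_le_log_of_pos (div_pos h2 h3))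
        (mul_pos h1 h2).le
      refine le_trans (le_of_eq ?_) h4
      field_simp
    simp_rw [Finset.sum_sub_distrib] at h
    linarith
  have hL : ∑ s, ∑ z, P s * q s z * Real.log (1 + q s z / pZ z) ≤ I + 1 := by
    refine le_trans ?_ (congrArg (I + ·) hPp).le
    rw [hI]
    simp_rw [← Finset.sum_add_distrib]
    refine Finset.sum_le_sum fun s _ => Finset.sum_le_sum fun z _ => ?_
    rcases (hP s).eq_or_lt with h1 | h1
    · simp [← h1]
    rcases (hq s z).eq_or_lt with h2 | h2
    · simpa [← h2] using mul_nonneg h1.le (hpZ0 z)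
    have h3 := hpZpos s z h1 h2
    have h4 : Real.log (1 + q s z / pZ z) ≤ Real.log (q s z / pZ z) + pZ z / q s z := by
      have h5 : 1 + q s z / pZ z = q s z / pZ z * (1 + pZ z / q s z) := by field_simp; ring
      rw [h5, Real.log_mul (by positivity) (by positivity)]
      have := Real.log_le_sub_one_of_pos (by positivity : 0 < 1 + pZ z / q s z)
      linarith
    refine (mul_le_mul_of_nonneg_left h4 (mul_pos h1 h2).le).trans (le_of_eq ?_)
    field_simp
  have hI1 : 0 < I + 1 := by linarith
  obtain ⟨w, hw, hw1, hwq, hwH⟩ :=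
    exists_functional_representation_aux hP hP1 hq hq1 hpZ (inv_pos.2 hI1)
  refine ⟨w, hw, hw1, hwq, hwH.trans ?_⟩
  rw [Real.log_inv, neg_neg]
  have h1 := mul_le_mul_of_nonneg_left hL (by positivity : 0 ≤ 1 + (I + 1)⁻¹)
  have h2 : (1 + (I + 1)⁻¹) * (I + 1) = I + 2 := by field_simp; ring
  linarith

end FunctionalRepresentation

lemma infH_comp_injective {Ω α β : Type*} [MeasurableSpace Ω] [Fintype α] [Fintype β]
    (P : Measure Ω) (X : Ω → α) {g : α → β} (hg : Function.Injective g) :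
    infH P (fun ω => g (X ω)) = infH P X := by
  classical
  unfold infH
  symm
  refine Finset.sum_of_injOn g hg.injOn (by simp) (fun b _ hb => ?_) fun a _ => ?_
  · have : (fun ω => g (X ω)) ⁻¹' {b} = ∅ := by
      ext ω
      simp only [Set.mem_preimage, Set.mem_singleton_iff, Set.mem_empty_iff_false, iff_false]
      exact fun h => hb ⟨X ω, by simp, h⟩
    simp [this]
  · have : (fun ω => g (X ω)) ⁻¹' {g a} = X ⁻¹' {a} := by
      ext ω
      simp [hg.eq_iff]
    rw [this]

lemma infH_map {Ω α β : Type*} [MeasurableSpace Ω] [MeasurableSpace β] [MeasurableSingletonClass β]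
    [Finite β] [Fintype α] (P : Measure Ω) {T : Ω → β} (hT : Measurable T) (g : β → α) :
    infH (P.map T) g = infH P (fun ω => g (T ω)) := by
  unfold infH
  refine Finset.sum_congr rfl fun a _ => ?_
  rw [Measure.map_apply hT (Set.toFinite _).measurableSet]
  rfl

lemma infH_eq_sum_of_real {Ω α : Type*} [MeasurableSpace Ω] [Fintype Ω] [Fintype α] [DecidableEq α]
    {P : Measure Ω} {m : Ω → ℝ}
    (hP : ∀ A : Set Ω, P.real A = ∑ ω, A.indicator m ω) (X : Ω → α) :
    infH P X = ∑ a, Real.negMulLog (∑ ω, if X ω = a then m ω else 0) := by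
  unfold infH
  refine Finset.sum_congr rfl fun a _ => ?_
  rw [← measureReal_def, hP]
  simp [Set.indicator]

lemma exists_measure_of_weights {Ω : Type*} [Fintype Ω] {m : Ω → ℝ} (hm : ∀ ω, 0 ≤ m ω)
    (hm1 : ∑ ω, m ω = 1) :
    ∃ P : @Measure Ω ⊤, @IsProbabilityMeasure Ω ⊤ P ∧
      ∀ A : Set Ω, @Measure.real Ω ⊤ P A = ∑ ω, A.indicator m ω := by
  let : MeasurableSpace Ω := ⊤
  have hr : ∀ A : Set Ω, (∑ ω, ENNReal.ofReal (m ω) • Measure.dirac ω : Measure Ω) A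
      = ENNReal.ofReal (∑ ω, A.indicator m ω) := by
    intro A
    rw [Measure.finsetSum_apply, ENNReal.ofReal_sum_of_nonneg
      fun ω _ => Set.indicator_nonneg (fun ω _ => hm ω) ω]
    refine Finset.sum_congr rfl fun ω _ => ?_
    by_cases h : ω ∈ A <;> simp [h]
  refine ⟨∑ ω, ENNReal.ofReal (m ω) • Measure.dirac ω, ⟨?_⟩, fun A => ?_⟩
  · rw [hr]
    simp [hm1]
  · rw [measureReal_def, hr, ENNReal.toReal_ofReal
      (Finset.sum_nonneg fun ω _ => Set.indicator_nonneg (fun ω _ => hm ω) ω)]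

lemma sum_sum_negMulLog_mul {ι κ : Type*} [Fintype ι] [Fintype κ] {x : ι → ℝ} {y : ι → κ → ℝ}
    {c : ℝ} (hy : ∀ i, ∑ j, y i j = c) :
    ∑ i, ∑ j, Real.negMulLog (x i * y i j)
      = c * ∑ i, Real.negMulLog (x i) + ∑ i, x i * ∑ j, Real.negMulLog (y i j) := by
  simp_rw [Real.negMulLog_mul, Finset.sum_add_distrib, ← Finset.sum_mul, ← Finset.mul_sum, hy]
  rw [Finset.mul_sum]

/-- The conditional law of the second coordinate given the first. -/
lemma exists_channel {σ ζ : Type*} [Fintype σ] [Fintype ζ] {J : σ → ζ → ℝ}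
    (hJ : ∀ s z, 0 ≤ J s z) (hJ1 : ∑ s, ∑ z, J s z = 1) :
    ∃ q : σ → ζ → ℝ, (∀ s z, 0 ≤ q s z) ∧ (∀ s, ∑ z, q s z = 1) ∧
      ∀ s z, (∑ z', J s z') * q s z = J s z := by
  classical
  refine ⟨fun s z => if ∑ z', J s z' = 0 then ∑ s', J s' z else J s z / ∑ z', J s z',
    fun s z => ?_, fun s => ?_, fun s z => ?_⟩
  · beta_reduce
    split_ifs
    · exact Finset.sum_nonneg fun s _ => hJ s z
    · exact div_nonneg (hJ s z) (Finset.sum_nonneg fun z _ => hJ s z)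
  · by_cases h : ∑ z', J s z' = 0
    · simp only [h, if_true]
      rw [Finset.sum_comm, hJ1]
    · simp only [h, if_false]
      rw [← Finset.sum_div, div_self h]
  · by_cases h : ∑ z', J s z' = 0
    · rw [h, zero_mul]
      exact ((Finset.sum_eq_zero_iff_of_nonneg fun z _ => hJ s z).1 h z (Finset.mem_univ z)).symm
    · simp only [h, if_false]
      field_simp

lemma sum_mul_log_div_eq {σ ζ : Type*} [Fintype σ] [Fintype ζ] {J q : σ → ζ → ℝ} {P : σ → ℝ}
    {pZ : ζ → ℝ} (hJ : ∀ s z, 0 ≤ J s z) (hP : ∀ s, P s = ∑ z, J s z)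
    (hpZ : ∀ z, pZ z = ∑ s, J s z) (hq : ∀ s z, P s * q s z = J s z) :
    ∑ s, ∑ z, P s * q s z * Real.log (q s z / pZ z)
      = ∑ s, Real.negMulLog (P s) + ∑ z, Real.negMulLog (pZ z)
        - ∑ s, ∑ z, Real.negMulLog (J s z) := by
  have h : ∀ s z, P s * q s z * Real.log (q s z / pZ z)
      = J s z * (-Real.log (P s)) + J s z * (-Real.log (pZ z)) - Real.negMulLog (J s z) := by
    intro s z
    rw [Real.negMulLog, hq]
    rcases (hJ s z).eq_or_lt with h0 | h0
    · simp [← h0]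
    have hP0 : P s ≠ 0 := by
      intro h
      rw [← hq, h, zero_mul] at h0
      exact h0.false
    have hq0 : q s z ≠ 0 := by
      intro h
      rw [← hq, h, mul_zero] at h0
      exact h0.false
    have hp0 : 0 < pZ z := by
      rw [hpZ]
      exact h0.trans_le (Finset.single_le_sum (f := fun s => J s z) (fun s _ => hJ s z)
        (Finset.mem_univ s))
    rw [Real.log_div hq0 hp0.ne', ← hq s z, Real.log_mul hP0 hq0]
    ring
  simp_rw [h, Finset.sum_sub_distrib, Finset.sum_add_distrib, ← Finset.sum_mul, ← hP]
  rw [Finset.sum_comm (f := fun s z => J s z * -Real.log (pZ z))]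
  simp_rw [← Finset.sum_mul, ← hpZ, Real.negMulLog]
  simp

section RevealedInput

variable {σ ζ : Type*} [Fintype σ] [Fintype ζ]

/-- The random function together with the input, which is revealed when the coin shows `true`. -/
def revealedInput (ω : (σ → ζ) × σ × Bool) : (σ → ζ) × Option σ :=
  (ω.1, if ω.2.2 then some ω.2.1 else none)

/-- The weights of a random function, an input and a coin, all independent. -/
def revealWeight (w : (σ → ζ) → ℝ) (p : σ → ℝ) (α : ℝ) (ω : (σ → ζ) × σ × Bool) : ℝ :=
  w ω.1 * (p ω.2.1 * if ω.2.2 then α else 1 - α)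

variable [DecidableEq σ] {w : (σ → ζ) → ℝ} {p : σ → ℝ} {α : ℝ}

lemma sum_revealWeight (hw : ∑ f, w f = 1) (hp : ∑ s, p s = 1) :
    ∑ ω, revealWeight w p α ω = 1 := by
  simp [revealWeight, Fintype.sum_prod_type, ← Finset.mul_sum, hw, hp, ← mul_add]

lemma sum_negMulLog_revealWeight (hw : ∑ f, w f = 1) (hp : ∑ s, p s = 1) :
    ∑ ω, Real.negMulLog (revealWeight w p α ω)
      = ∑ f, Real.negMulLog (w f) + ∑ s, Real.negMulLog (p s)
        + (Real.negMulLog α + Real.negMulLog (1 - α)) := by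
  have h1 : ∀ _ : (σ → ζ), ∑ x : σ × Bool, (p x.1 * if x.2 then α else 1 - α) = 1 := by
    intro _
    simp [Fintype.sum_prod_type, ← mul_add, hp]
  have h2 : ∀ _ : σ, ∑ x : Bool, (if x then α else 1 - α) = 1 := by simp
  simp only [revealWeight]
  rw [Fintype.sum_prod_type, sum_sum_negMulLog_mul h1, ← Finset.sum_mul, hw, Fintype.sum_prod_type,
    sum_sum_negMulLog_mul h2, ← Finset.sum_mul, hp]
  simp
  ring

lemma sum_negMulLog_some (hw : ∑ f, w f = 1) (hp : ∑ s, p s = 1) :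
    ∑ f, ∑ s, Real.negMulLog (w f * (p s * α))
      = α * ∑ f, Real.negMulLog (w f) + α * ∑ s, Real.negMulLog (p s) + Real.negMulLog α := by
  have h : ∀ _ : (σ → ζ), ∑ s, p s * α = α := fun _ => by rw [← Finset.sum_mul, hp, one_mul]
  rw [sum_sum_negMulLog_mul h, ← Finset.sum_mul, hw]
  simp_rw [Real.negMulLog_mul, Finset.sum_add_distrib, ← Finset.mul_sum, ← Finset.sum_mul, hp]
  ring

variable [DecidableEq ζ]

lemma sum_revealWeight_none (f : σ → ζ) (hp : ∑ s, p s = 1) :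
    (∑ ω, if revealedInput ω = (f, none) then revealWeight w p α ω else 0) = w f * (1 - α) := by
  rw [Fintype.sum_prod_type, Finset.sum_eq_single f]
  · simp [revealedInput, revealWeight, Fintype.sum_prod_type, ← Finset.mul_sum, ← Finset.sum_mul, hp]
  · intro g _ hg
    simp [revealedInput, hg]
  · simp

lemma sum_revealWeight_some (f : σ → ζ) (s : σ) :
    (∑ ω, if revealedInput ω = (f, some s) then revealWeight w p α ω else 0)
      = w f * (p s * α) := by
  rw [Fintype.sum_prod_type, Finset.sum_eq_single f]
  · simp [revealedInput, revealWeight, Fintype.sum_prod_type]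
  · intro g _ hg
    simp [revealedInput, hg]
  · simp

lemma sum_revealWeight_none_output (f : σ → ζ) (z : ζ) :
    (∑ ω : (σ → ζ) × σ × Bool, if (revealedInput ω, ω.1 ω.2.1) = ((f, none), z)
      then revealWeight w p α ω else 0)
      = w f * ((1 - α) * ∑ s, if f s = z then p s else 0) := by
  rw [Fintype.sum_prod_type, Finset.sum_eq_single f]
  · simp only [revealedInput, revealWeight, Fintype.sum_prod_type, Finset.mul_sum]
    refine Finset.sum_congr rfl fun s _ => ?_
    by_cases h : f s = z
    · simp only [h, Fintype.sum_bool, Prod.mk.injEq, if_true, reduceCtorEq]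
      simp [mul_comm]
    · simp [h]
  · intro g _ hg
    simp [revealedInput, hg]
  · simp

lemma sum_revealWeight_some_output (f : σ → ζ) (s : σ) (z : ζ) :
    (∑ ω : (σ → ζ) × σ × Bool, if (revealedInput ω, ω.1 ω.2.1) = ((f, some s), z)
      then revealWeight w p α ω else 0)
      = if f s = z then w f * (p s * α) else 0 := by
  rw [Fintype.sum_prod_type, Finset.sum_eq_single f]
  · rw [Fintype.sum_prod_type, Finset.sum_eq_single s]
    · simp [revealedInput, revealWeight]
    · intro t _ ht
      simp [revealedInput, ht]
    · simp
  · intro g _ hg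
    simp [revealedInput, hg]
  · simp

lemma sum_negMulLog_revealedInput (hw : ∑ f, w f = 1) (hp : ∑ s, p s = 1) :
    ∑ v, Real.negMulLog (∑ ω, if revealedInput ω = v then revealWeight w p α ω else 0)
      = ∑ f, Real.negMulLog (w f) + α * ∑ s, Real.negMulLog (p s)
        + (Real.negMulLog α + Real.negMulLog (1 - α)) := by
  simp_rw [Fintype.sum_prod_type (f := fun v : (σ → ζ) × Option σ => Real.negMulLog _),
    Fintype.sum_option, sum_revealWeight_none _ hp, sum_revealWeight_some, Finset.sum_add_distrib,
    sum_negMulLog_some hw hp, Real.negMulLog_mul, Finset.sum_add_distrib, ← Finset.mul_sum,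
    ← Finset.sum_mul, hw]
  ring

lemma sum_negMulLog_revealedInput_output (hw : ∑ f, w f = 1) (hp : ∑ s, p s = 1) :
    ∑ v : ((σ → ζ) × Option σ) × ζ, Real.negMulLog (∑ ω : (σ → ζ) × σ × Bool,
        if (revealedInput ω, ω.1 ω.2.1) = v then revealWeight w p α ω else 0)
      = ∑ f, Real.negMulLog (w f) + α * ∑ s, Real.negMulLog (p s)
        + (Real.negMulLog α + Real.negMulLog (1 - α))
        + (1 - α) * ∑ f, w f * ∑ z, Real.negMulLog (∑ s, if f s = z then p s else 0) := by
  have h1 : ∀ f : σ → ζ, ∑ z, (∑ s, if f s = z then p s else 0) = 1 := by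
    intro f
    rw [Finset.sum_comm, ← hp]
    simp
  have h2 : ∀ (f : σ → ζ) s,
      ∑ z, Real.negMulLog (if f s = z then w f * (p s * α) else 0)
        = Real.negMulLog (w f * (p s * α)) := by
    intro f s
    rw [Finset.sum_eq_single (f s)]
    · simp
    · intro z _ hz
      simp [hz.symm]
    · simp
  have h3 : ∀ f : σ → ζ, ∑ z, (1 - α) * (∑ s, if f s = z then p s else 0) = 1 - α := by
    intro f
    rw [← Finset.mul_sum, h1, mul_one]
  have h4 : ∀ f : σ → ζ, ∑ z, Real.negMulLog ((1 - α) * (∑ s, if f s = z then p s else 0))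
      = Real.negMulLog (1 - α)
        + (1 - α) * ∑ z, Real.negMulLog (∑ s, if f s = z then p s else 0) := by
    intro f
    simp_rw [Real.negMulLog_mul, Finset.sum_add_distrib, ← Finset.sum_mul, ← Finset.mul_sum, h1,
      one_mul]
  rw [Fintype.sum_prod_type, Fintype.sum_prod_type]
  simp_rw [Fintype.sum_option, sum_revealWeight_none_output, sum_revealWeight_some_output, h2,
    Finset.sum_add_distrib]
  rw [sum_negMulLog_some hw hp, sum_sum_negMulLog_mul h3]
  simp_rw [h4, mul_add, Finset.sum_add_distrib, ← Finset.sum_mul, hw, mul_left_comm _ (1 - α)]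
  rw [← Finset.mul_sum]
  ring

end RevealedInput

/-- **Extended Strong Functional Representation Lemma.** Let `S` and `Z` be
random variables on finite alphabets with joint distribution `μ = P_{S,Z}`, `H(S) > 0`, and
`0 ≤ ε ≤ H(S)`; set `α = ε / H(S)`.  Then there exists a random variable `U` (on a probability
space carrying a copy of `(S,Z)`) such that `I(U;S) = ε`, `H(Z|S,U) = 0`, and
`I(U;S|Z) ≤ α·H(S|Z) + (1−α)·(log(I(S;Z) + 1) + 4)`. -/
theorem extended_strong_functional_representation_lemma
    {σ ζ : Type} [Fintype σ] [MeasurableSpace σ] [MeasurableSingletonClass σ]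
    [Fintype ζ] [MeasurableSpace ζ] [MeasurableSingletonClass ζ]
    (μ : Measure (σ × ζ)) [IsProbabilityMeasure μ]
    (hHS : 0 < infH μ Prod.fst)
    {ε : ℝ} (hε : 0 ≤ ε) (hεH : ε ≤ infH μ Prod.fst) :
    ∃ (Ω : Type) (_ : MeasurableSpace Ω) (P : Measure Ω) (_ : IsProbabilityMeasure P)
      (Sv : Ω → σ) (Zv : Ω → ζ) (n : ℕ) (U : Ω → Fin n),
      Measurable Sv ∧ Measurable Zv ∧ Measurable U ∧
      P.map (fun ω => (Sv ω, Zv ω)) = μ ∧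
      infMI P U Sv = ε ∧
      infCondH P Zv (fun ω => (Sv ω, U ω)) = 0 ∧
      infCMI P U Sv Zv ≤
        (ε / infH μ Prod.fst) * infCondH μ Prod.fst Prod.snd
          + (1 - ε / infH μ Prod.fst)
            * (Real.log (infMI μ Prod.fst Prod.snd + 1) + 4) := by
  classical
  set p : σ → ℝ := fun s => μ.real (Prod.fst ⁻¹' {s}) with hpdef
  set pZ : ζ → ℝ := fun z => μ.real (Prod.snd ⁻¹' {z}) with hpZdef
  set J : σ → ζ → ℝ := fun s z => μ.real {(s, z)} with hJdef
  have hreal : ∀ A : Set (σ × ζ), μ.real A = ∑ s, ∑ z, if (s, z) ∈ A then J s z else 0 := by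
    intro A
    rw [← Fintype.sum_prod_type' (f := fun s z => if (s, z) ∈ A then J s z else 0),
      ← Finset.sum_filter]
    simp only [hJdef]
    rw [sum_measureReal_singleton]
    congr 1
    ext x
    simp
  have hp : ∀ s, p s = ∑ z, J s z := by
    intro s
    simp only [hpdef]
    rw [hreal, Finset.sum_eq_single s]
    · simp
    · intro t _ ht
      simp [ht]
    · simp
  have hpZ : ∀ z, pZ z = ∑ s, J s z := by
    intro z
    simp only [hpZdef]
    rw [hreal]
    simp
  have hJ0 : ∀ s z, 0 ≤ J s z := fun s z => measureReal_nonneg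
  have hJ1 : ∑ s, ∑ z, J s z = 1 := by
    have := hreal Set.univ
    simpa using this.symm
  have hp0 : ∀ s, 0 ≤ p s := fun s => measureReal_nonneg
  have hp1 : ∑ s, p s = 1 := by simp_rw [hp, hJ1]
  obtain ⟨q, hq0, hq1, hqJ⟩ := exists_channel hJ0 hJ1
  simp_rw [← hp] at hqJ
  have hHS' : infH μ Prod.fst = ∑ s, Real.negMulLog (p s) := rfl
  have hHZ' : infH μ Prod.snd = ∑ z, Real.negMulLog (pZ z) := rfl
  have hHSZ' : infH μ (fun ω => (ω.1, ω.2)) = ∑ s, ∑ z, Real.negMulLog (J s z) := by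
    rw [← Fintype.sum_prod_type' (f := fun s z => Real.negMulLog (J s z))]
    rfl
  obtain ⟨w, hw0, hw1, hwq, hwH⟩ := exists_functional_representation hp0 hp1 hq0 hq1
    (pZ := pZ) (fun z => by simp_rw [hpZ, hqJ]) (I := infMI μ Prod.fst Prod.snd)
    (by rw [sum_mul_log_div_eq hJ0 hp hpZ hqJ, infMI, hHS', hHZ', hHSZ'])
  set α := ε / infH μ Prod.fst with hα
  have hα0 : 0 ≤ α := div_nonneg hε hHS.le
  have hα1 : α ≤ 1 := (div_le_one hHS).2 hεH
  have hαε : α * infH μ Prod.fst = ε := div_mul_cancel₀ _ hHS.ne'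
  obtain ⟨P, hPprob, hP⟩ := exists_measure_of_weights (m := revealWeight w p α)
    (fun ω => mul_nonneg (hw0 _) (mul_nonneg (hp0 _) (by split_ifs <;> linarith)))
    (sum_revealWeight hw1 hp1)
  let : MeasurableSpace ((σ → ζ) × σ × Bool) := ⊤
  let S : (σ → ζ) × σ × Bool → σ := fun ω => ω.2.1
  let Z : (σ → ζ) × σ × Bool → ζ := fun ω => ω.1 ω.2.1
  let e := Fintype.equivFin ((σ → ζ) × Option σ)
  have hSZm : Measurable fun ω => (S ω, Z ω) := measurable_from_top
  have hmap : P.map (fun ω => (S ω, Z ω)) = μ := by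
    refine Measure.ext_of_singleton fun x => ?_
    rw [Measure.map_apply hSZm (measurableSet_singleton x),
      ← ENNReal.toReal_eq_toReal_iff' (measure_ne_top _ _) (measure_ne_top _ _),
      ← measureReal_def, ← measureReal_def, hP]
    obtain ⟨s, z⟩ := x
    rw [show μ.real {(s, z)} = J s z from rfl, ← hqJ, ← hwq, Fintype.sum_prod_type, Finset.mul_sum]
    refine Finset.sum_congr rfl fun f _ => ?_
    rw [Fintype.sum_prod_type, Finset.sum_eq_single s]
    · by_cases h : f s = z
      · simp [Set.indicator, S, Z, h, revealWeight]
        ring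
      · simp [Set.indicator, S, Z, h]
    · intro t _ ht
      simp [Set.indicator, S, ht]
    · simp
  have hHS : infH P S = infH μ Prod.fst := by rw [← hmap, infH_map P hSZm]
  have hHZ : infH P Z = infH μ Prod.snd := by rw [← hmap, infH_map P hSZm]
  have hHSZ : infH P (fun ω => (S ω, Z ω)) = infH μ (fun ω => (ω.1, ω.2)) := by
    conv_rhs => rw [← hmap]
    rw [infH_map P hSZm]
  have hid : infH P (fun ω => ω) = ∑ f, Real.negMulLog (w f) + infH μ Prod.fst
        + (Real.negMulLog α + Real.negMulLog (1 - α)) := by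
    rw [infH_eq_sum_of_real hP, hHS', ← sum_negMulLog_revealWeight hw1 hp1]
    simp
  have hinj : ∀ ω ω' : (σ → ζ) × σ × Bool, revealedInput ω = revealedInput ω' → S ω = S ω' →
      ω = ω' := by
    rintro ⟨f, s, b⟩ ⟨f', s', b'⟩ h1 h2
    obtain rfl : s = s' := h2
    obtain rfl : f = f' := congrArg Prod.fst h1
    cases b <;> cases b' <;> simp [revealedInput] at h1 ⊢
  have hHU : infH P (fun ω => e (revealedInput ω)) = ∑ f, Real.negMulLog (w f)
      + α * infH μ Prod.fst + (Real.negMulLog α + Real.negMulLog (1 - α)) := by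
    rw [infH_comp_injective P revealedInput e.injective, infH_eq_sum_of_real hP,
      sum_negMulLog_revealedInput hw1 hp1, hHS']
  have hHUZ : infH P (fun ω => (e (revealedInput ω), Z ω)) = ∑ f, Real.negMulLog (w f)
      + α * infH μ Prod.fst + (Real.negMulLog α + Real.negMulLog (1 - α))
      + (1 - α) * ∑ f, w f * ∑ z, Real.negMulLog (∑ s, if f s = z then p s else 0) := by
    have h := infH_comp_injective P (fun ω => (revealedInput ω, Z ω))
      (e.injective.prodMap (Function.injective_id (α := ζ)))
    simp only [Prod.map_apply, id_eq] at h
    rw [h, infH_eq_sum_of_real hP, sum_negMulLog_revealedInput_output hw1 hp1, hHS']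
  have hinj' : ∀ ω ω', e (revealedInput ω) = e (revealedInput ω') → S ω = S ω' → ω = ω' :=
    fun ω ω' h => hinj ω ω' (e.injective h)
  have hHUS : infH P (fun ω => (e (revealedInput ω), S ω)) = infH P (fun ω => ω) := by
    refine infH_comp_injective P (fun ω => ω) (g := fun ω => (e (revealedInput ω), S ω)) ?_
    intro ω ω' h
    simp only [Prod.mk.injEq] at h
    exact hinj' ω ω' h.1 h.2
  have hHSU : infH P (fun ω => (S ω, e (revealedInput ω))) = infH P (fun ω => ω) := by
    refine infH_comp_injective P (fun ω => ω) (g := fun ω => (S ω, e (revealedInput ω))) ?_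
    intro ω ω' h
    simp only [Prod.mk.injEq] at h
    exact hinj' ω ω' h.2 h.1
  have hHZSU : infH P (fun ω => (Z ω, (S ω, e (revealedInput ω)))) = infH P (fun ω => ω) := by
    refine infH_comp_injective P (fun ω => ω)
      (g := fun ω => (Z ω, (S ω, e (revealedInput ω)))) ?_
    intro ω ω' h
    simp only [Prod.mk.injEq] at h
    exact hinj' ω ω' h.2.2 h.2.1
  have hHUSZ : infH P (fun ω => ((e (revealedInput ω), S ω), Z ω)) = infH P (fun ω => ω) := by
    refine infH_comp_injective P (fun ω => ω)
      (g := fun ω => ((e (revealedInput ω), S ω), Z ω)) ?_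
    intro ω ω' h
    simp only [Prod.mk.injEq] at h
    exact hinj' ω ω' h.1.1 h.1.2
  refine ⟨(σ → ζ) × σ × Bool, ⊤, P, hPprob, S, Z, _, fun ω => e (revealedInput ω),
    measurable_from_top, measurable_from_top, measurable_from_top, hmap, ?_, ?_, ?_⟩
  · rw [infMI, hHU, hHS, hHUS, hid, ← hαε]
    ring
  · rw [infCondH, hHZSU, hHSU, sub_self]
  · rw [infCMI, infCondH, infCondH, infCondH, hHUZ, hHSZ, hHUSZ, hHZ, hid, infCondH]
    have h := mul_le_mul_of_nonneg_left hwH (sub_nonneg.2 hα1)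
    have hI : infMI μ Prod.fst Prod.snd
      = infH μ Prod.fst + infH μ Prod.snd - infH μ (fun ω => (ω.1, ω.2)) := rfl
    generalize Real.log (infMI μ Prod.fst Prod.snd + 1) = l at h ⊢
    rw [hI] at h
    linarith [sub_nonneg.2 hα1]
end

section
/- Let S and Z be random variables on finite alphabets with joint distribution P_{S,Z}, and let ε satisfy 0 ≤ ε ≤ H(S). Then there exists a random variable U, jointly distributed with (S,Z), such that I(U;S) = ε and I(U;Z) ≥ H(Z|S) − H(S|Z) + ε. In particular, h_ε(P_{S,Z}) ≥ L_h^1(ε) := H(Z|S) − H(S|Z) + ε. (First lower bound of Theorem 1, with Z playing the role of the semantic f(X).) -/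
open MeasureTheory ProbabilityTheory

/-- The privacy–utility trade-off `h_ε(P_{S,Z})`: the supremum of `I(U;Z)` over all
random variables `U` (with finite alphabet), defined on some probability space carrying a
copy of `(S,Z)` with joint distribution `μ`, subject to the leakage constraint `I(U;S) ≤ ε`. -/
noncomputable def hEps {σ ζ : Type} [Fintype σ] [MeasurableSpace σ] [MeasurableSingletonClass σ]
    [Fintype ζ] [MeasurableSpace ζ] [MeasurableSingletonClass ζ]
    (μ : Measure (σ × ζ)) (ε : ℝ) : ℝ :=
  sSup { r : ℝ | ∃ (Ω : Type) (_ : MeasurableSpace Ω) (P : Measure Ω)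
    (_ : IsProbabilityMeasure P) (Sv : Ω → σ) (Zv : Ω → ζ) (n : ℕ) (U : Ω → Fin n),
    Measurable Sv ∧ Measurable Zv ∧ Measurable U ∧
    P.map (fun ω => (Sv ω, Zv ω)) = μ ∧
    infMI P U Sv ≤ ε ∧ r = infMI P U Zv }

section EntropyLemmas

variable {Ω Ω' α β : Type*} [MeasurableSpace Ω] [MeasurableSpace Ω'] [Fintype α] [Fintype β]

lemma negMulLog_sum_le {ι : Type*} (s : Finset ι) (x : ι → ℝ) (hx : ∀ i, 0 ≤ x i) :
    Real.negMulLog (∑ i ∈ s, x i) ≤ ∑ i ∈ s, Real.negMulLog (x i) := by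
  have hsum : Real.negMulLog (∑ i ∈ s, x i) = ∑ i ∈ s, -x i * Real.log (∑ j ∈ s, x j) := by
    rw [Real.negMulLog, ← Finset.sum_mul, Finset.sum_neg_distrib]
  rw [hsum]
  refine Finset.sum_le_sum fun i hi => ?_
  rw [Real.negMulLog]
  rcases (hx i).eq_or_lt with h | h
  · simp [← h]
  · have hle : x i ≤ ∑ j ∈ s, x j := Finset.single_le_sum (fun j _ => hx j) hi
    nlinarith [Real.log_le_log h hle]

/-- Entropy does not increase under a deterministic map. -/
lemma infH_le_of_comp (P : Measure Ω) [IsFiniteMeasure P] {X : Ω → α} {Y : Ω → β}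
    (hX : ∀ a, MeasurableSet (X ⁻¹' {a})) (f : α → β) (hY : ∀ ω, Y ω = f (X ω)) :
    infH P Y ≤ infH P X := by
  classical
  have hfib : ∀ b, (P (Y ⁻¹' {b})).toReal = ∑ a with f a = b, (P (X ⁻¹' {a})).toReal := by
    intro b
    have hset : Y ⁻¹' {b} = ⋃ a ∈ Finset.univ.filter (fun a => f a = b), X ⁻¹' {a} := by
      ext ω
      simp [hY]
    rw [hset, measure_biUnion_finset _ (fun a _ => hX a),
      ENNReal.toReal_sum fun a _ => measure_ne_top _ _]
    intro a _ a' _ haa'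
    exact Disjoint.preimage X (by simpa using haa')
  unfold infH
  rw [← Finset.sum_fiberwise (s := Finset.univ) (g := f)]
  refine Finset.sum_le_sum fun b _ => ?_
  rw [hfib b]
  exact negMulLog_sum_le _ _ fun _ => ENNReal.toReal_nonneg

/-- Two random variables that determine each other have the same entropy. -/
lemma infH_eq_of_comp (P : Measure Ω) [IsFiniteMeasure P] {X : Ω → α} {Y : Ω → β}
    (hX : ∀ a, MeasurableSet (X ⁻¹' {a})) (hY : ∀ b, MeasurableSet (Y ⁻¹' {b}))
    (f : α → β) (g : β → α) (hf : ∀ ω, Y ω = f (X ω)) (hg : ∀ ω, X ω = g (Y ω)) :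
    infH P Y = infH P X :=
  le_antisymm (infH_le_of_comp P hX f hf) (infH_le_of_comp P hY g hg)

lemma infH_map_s5 (P : Measure Ω) {T : Ω → Ω'} (hT : Measurable T) {X : Ω' → α}
    (hX : ∀ a, MeasurableSet (X ⁻¹' {a})) :
    infH (P.map T) X = infH P (fun ω => X (T ω)) := by
  unfold infH
  refine Finset.sum_congr rfl fun a _ => ?_
  rw [Measure.map_apply hT (hX a)]
  rfl

lemma sum_toReal_measure_preimage_singleton (P : Measure Ω) [IsProbabilityMeasure P]
    {X : Ω → α} (hX : ∀ a, MeasurableSet (X ⁻¹' {a})) :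
    ∑ a, (P (X ⁻¹' {a})).toReal = 1 := by
  rw [← ENNReal.toReal_sum fun a _ => measure_ne_top _ _,
    sum_measure_preimage_singleton _ fun a _ => hX a]
  simp

/-- The entropy of an independent pair is the sum of the entropies. -/
lemma infH_prod (P : Measure Ω) (Q : Measure Ω') [IsProbabilityMeasure P] [IsProbabilityMeasure Q]
    {X : Ω → α} {Y : Ω' → β} (hX : ∀ a, MeasurableSet (X ⁻¹' {a}))
    (hY : ∀ b, MeasurableSet (Y ⁻¹' {b})) :
    infH (P.prod Q) (fun ω => (X ω.1, Y ω.2)) = infH P X + infH Q Y := by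
  have hpre : ∀ a b, (fun ω : Ω × Ω' => (X ω.1, Y ω.2)) ⁻¹' {(a, b)}
      = (X ⁻¹' {a}) ×ˢ (Y ⁻¹' {b}) := by
    intro a b
    ext ω
    simp
  unfold infH
  rw [Fintype.sum_prod_type]
  simp_rw [hpre, Measure.prod_prod, ENNReal.toReal_mul, Real.negMulLog_mul,
    Finset.sum_add_distrib, ← Finset.sum_mul, ← Finset.mul_sum, ← Finset.sum_mul]
  rw [sum_toReal_measure_preimage_singleton P hX, sum_toReal_measure_preimage_singleton Q hY]
  ring

/-- Mutual information is bounded by the entropy of the second variable. -/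
lemma infMI_le_infH (P : Measure Ω) [IsFiniteMeasure P] {X : Ω → α} {Y : Ω → β}
    (hX : ∀ a, MeasurableSet (X ⁻¹' {a})) (hY : ∀ b, MeasurableSet (Y ⁻¹' {b})) :
    infMI P X Y ≤ infH P Y := by
  have hXY : ∀ c : α × β, MeasurableSet ((fun ω => (X ω, Y ω)) ⁻¹' {c}) := by
    rintro ⟨a, b⟩
    convert (hX a).inter (hY b) using 1
    ext ω
    simp
  have := infH_le_of_comp P (Y := X) hXY Prod.fst fun _ => rfl
  unfold infMI
  linarith

end EntropyLemmas

/-- The law on `Bool` giving mass `a` to `true` and `1 - a` to `false`. -/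
noncomputable def coinLaw (a : ℝ) : Measure Bool :=
  ENNReal.ofReal a • Measure.dirac true + ENNReal.ofReal (1 - a) • Measure.dirac false

lemma isProbabilityMeasure_coinLaw {a : ℝ} (h0 : 0 ≤ a) (h1 : a ≤ 1) :
    IsProbabilityMeasure (coinLaw a) := by
  constructor
  simp [coinLaw, ← ENNReal.ofReal_add h0 (sub_nonneg.2 h1)]

/-- The erasure of `s`: it is revealed exactly when the coin shows `true`. -/
def erasure {σ : Type*} (ω : Bool × σ) : Option σ := if ω.1 then some ω.2 else none

/-- The entropy of the output of an erasure channel that reveals its input with probability `a`. -/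
lemma infH_erasure {σ : Type*} [Fintype σ] [MeasurableSpace σ] [MeasurableSingletonClass σ]
    (p : Measure σ) [IsProbabilityMeasure p] {a : ℝ} (h0 : 0 ≤ a) (h1 : a ≤ 1) :
    infH ((coinLaw a).prod p) erasure = infH (coinLaw a) id + a * infH p id := by
  have := isProbabilityMeasure_coinLaw h0 h1
  have hnone : (erasure ⁻¹' {none} : Set (Bool × σ)) = {false} ×ˢ Set.univ := by
    ext ⟨b, s⟩
    cases b <;> simp [erasure]
  have hsome : ∀ s, (erasure ⁻¹' {some s} : Set (Bool × σ)) = {true} ×ˢ {s} := by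
    intro s
    ext ⟨b, t⟩
    cases b <;> simp [erasure]
  have hp := sum_toReal_measure_preimage_singleton p (X := id)
    fun s => measurableSet_singleton s
  have hf : (coinLaw a {false}).toReal = 1 - a := by simp [coinLaw, h1]
  have ht : (coinLaw a {true}).toReal = a := by simp [coinLaw, h0]
  simp only [Set.preimage_id] at hp
  unfold infH
  simp only [Fintype.sum_option, hnone, hsome, Measure.prod_prod, ENNReal.toReal_mul, hf, ht,
    Real.negMulLog_mul, Finset.sum_add_distrib, ← Finset.sum_mul, ← Finset.mul_sum, hp,
    Fintype.sum_bool, Set.preimage_id, measure_univ, ENNReal.toReal_one, Real.negMulLog_one]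
  ring

lemma prod_pi_condKernel_map_eval {σ ζ β : Type*} [Fintype σ] [MeasurableSpace σ]
    [MeasurableSingletonClass σ] [Fintype ζ] [Nonempty ζ] [MeasurableSpace ζ]
    [MeasurableSingletonClass ζ] [MeasurableSpace β] [Finite β] [MeasurableSingletonClass β]
    (μ : Measure (σ × ζ)) [IsProbabilityMeasure μ] (ν : Measure β) [IsProbabilityMeasure ν] :
    ((Measure.pi fun s => μ.condKernel s).prod (ν.prod μ.fst)).map
      (fun ω : (σ → ζ) × β × σ => (ω.2.2, ω.1 ω.2.2)) = μ := by
  refine Measure.ext_of_singleton ?_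
  rintro ⟨s, z⟩
  rw [Measure.map_apply (measurable_of_finite _) (measurableSet_singleton _)]
  have hpre : (fun ω : (σ → ζ) × β × σ => (ω.2.2, ω.1 ω.2.2)) ⁻¹' {(s, z)}
      = ((Function.eval s : (σ → ζ) → ζ) ⁻¹' {z}) ×ˢ (Set.univ ×ˢ {s}) := by
    ext ⟨g, b, t⟩
    simp only [Set.mem_preimage, Set.mem_singleton_iff, Prod.mk.injEq, Set.mem_prod,
      Set.mem_univ, true_and, Function.eval]
    constructor
    · rintro ⟨rfl, h⟩
      exact ⟨h, rfl⟩
    · rintro ⟨h, rfl⟩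
      exact ⟨rfl, h⟩
  rw [hpre, Measure.prod_prod, Measure.prod_prod, measure_univ, one_mul,
    (measurePreserving_eval (fun s => μ.condKernel s) s).measure_preimage
      (measurableSet_singleton z).nullMeasurableSet]
  by_cases hs : μ.fst {s} = 0
  · rw [hs, mul_zero, eq_comm]
    refine measure_mono_null ?_ ((Measure.fst_apply (measurableSet_singleton s)).symm.trans hs)
    rintro _ rfl
    rfl
  · rw [Measure.condKernel_apply_of_ne_zero hs, mul_comm, ← mul_assoc,
      ENNReal.mul_inv_cancel hs (measure_ne_top _ _), one_mul, Set.singleton_prod_singleton]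

/-- **first lower bound of Theorem 1.** Let `S` and `Z` have joint distribution
`μ = P_{S,Z}` and `0 ≤ ε ≤ H(S)`.  Then there exists a random variable `U` (on a probability
space carrying a copy of `(S,Z)`) with `I(U;S) = ε` and
`I(U;Z) ≥ H(Z|S) − H(S|Z) + ε`.  In particular `h_ε(P_{S,Z}) ≥ L_h^1(ε) := H(Z|S) − H(S|Z) + ε`. -/
theorem first_lower_bound_tradeoff
    {σ ζ : Type} [Fintype σ] [MeasurableSpace σ] [MeasurableSingletonClass σ]
    [Fintype ζ] [MeasurableSpace ζ] [MeasurableSingletonClass ζ]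
    (μ : Measure (σ × ζ)) [IsProbabilityMeasure μ]
    {ε : ℝ} (hε : 0 ≤ ε) (hεH : ε ≤ infH μ Prod.fst) :
    (∃ (Ω : Type) (_ : MeasurableSpace Ω) (P : Measure Ω) (_ : IsProbabilityMeasure P)
      (Sv : Ω → σ) (Zv : Ω → ζ) (n : ℕ) (U : Ω → Fin n),
      Measurable Sv ∧ Measurable Zv ∧ Measurable U ∧
      P.map (fun ω => (Sv ω, Zv ω)) = μ ∧
      infMI P U Sv = ε ∧
      infMI P U Zv ≥ infCondH μ Prod.snd Prod.fst - infCondH μ Prod.fst Prod.snd + ε) ∧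
    hEps μ ε ≥ infCondH μ Prod.snd Prod.fst - infCondH μ Prod.fst Prod.snd + ε := by
  classical
  have hdiff : infCondH μ Prod.snd Prod.fst - infCondH μ Prod.fst Prod.snd
      = infH μ Prod.snd - infH μ Prod.fst := by
    have hswap : infH μ (fun ω => (ω.2, ω.1)) = infH μ (fun ω => (ω.1, ω.2)) :=
      infH_eq_of_comp μ (fun _ => Set.Finite.measurableSet (Set.toFinite _))
        (fun _ => Set.Finite.measurableSet (Set.toFinite _)) Prod.swap Prod.swap
        (fun _ => rfl) fun _ => rfl
    unfold infCondH
    linarith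
  rw [hdiff]
  have hfst : infH μ.fst id = infH μ Prod.fst :=
    infH_map_s5 μ measurable_fst fun s => measurableSet_singleton s
  have hmarg : ∀ {Ω : Type} [MeasurableSpace Ω] (P : Measure Ω) (Sv : Ω → σ) (Zv : Ω → ζ),
      Measurable Sv → Measurable Zv → P.map (fun ω => (Sv ω, Zv ω)) = μ →
      infH P Sv = infH μ Prod.fst ∧ infH P Zv = infH μ Prod.snd := by
    intro Ω _ P Sv Zv hS hZ hP
    constructor
    · rw [← hP, infH_map_s5 P (hS.prodMk hZ) fun s => measurable_fst (measurableSet_singleton s)]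
    · rw [← hP, infH_map_s5 P (hS.prodMk hZ) fun z => measurable_snd (measurableSet_singleton z)]
  have hex : ∃ (Ω : Type) (_ : MeasurableSpace Ω) (P : Measure Ω) (_ : IsProbabilityMeasure P)
      (Sv : Ω → σ) (Zv : Ω → ζ) (n : ℕ) (U : Ω → Fin n),
      Measurable Sv ∧ Measurable Zv ∧ Measurable U ∧
      P.map (fun ω => (Sv ω, Zv ω)) = μ ∧
      infMI P U Sv = ε ∧
      infMI P U Zv ≥ infH μ Prod.snd - infH μ Prod.fst + ε := by
    obtain ⟨a, h0, h1, ha⟩ : ∃ a : ℝ, 0 ≤ a ∧ a ≤ 1 ∧ a * infH μ Prod.fst = ε := by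
      have hH := hε.trans hεH
      refine ⟨ε / infH μ Prod.fst, div_nonneg hε hH, div_le_one_of_le₀ hεH hH, ?_⟩
      rcases hH.eq_or_lt with h | h
      · rw [← h] at hεH ⊢
        linarith
      · exact div_mul_cancel₀ _ h.ne'
    have := isProbabilityMeasure_coinLaw h0 h1
    have : Nonempty ζ := (nonempty_of_isProbabilityMeasure μ).map Prod.snd
    let π : Measure (σ → ζ) := Measure.pi fun s => μ.condKernel s
    let Q : Measure (Bool × σ) := (coinLaw a).prod μ.fst
    let P := π.prod Q
    let e := Fintype.equivFin ((σ → ζ) × Option σ)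
    let U : (σ → ζ) × Bool × σ → Fin _ := fun ω => e (ω.1, erasure ω.2)
    have hmeas : ∀ s : Set ((σ → ζ) × Bool × σ), MeasurableSet s :=
      fun s => (Set.toFinite s).measurableSet
    have hmeasQ : ∀ s : Set (Bool × σ), MeasurableSet s := fun s => (Set.toFinite s).measurableSet
    have hmap := prod_pi_condKernel_map_eval μ (coinLaw a)
    obtain ⟨hHS, hHZ⟩ := hmarg P (fun ω => ω.2.2) (fun ω => ω.1 ω.2.2)
      (measurable_of_finite _) (measurable_of_finite _) hmap
    have hHU : infH P U = infH π id + (infH (coinLaw a) id + a * infH μ Prod.fst) := by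
      rw [← hfst, ← infH_erasure μ.fst h0 h1,
        ← infH_prod π Q (X := id) (fun g => measurableSet_singleton g) fun _ => hmeasQ _]
      exact infH_eq_of_comp P (fun _ => hmeas _) (fun _ => hmeas _) e e.symm
        (fun _ => rfl) fun _ => (e.symm_apply_apply _).symm
    have hHUS : infH P (fun ω => (U ω, ω.2.2))
        = infH π id + (infH (coinLaw a) id + infH μ Prod.fst) := by
      rw [← hfst, ← infH_prod (coinLaw a) μ.fst (X := id) (Y := id)
          (fun b => measurableSet_singleton b) fun s => measurableSet_singleton s,
        ← infH_prod π Q (X := id) (fun g => measurableSet_singleton g) fun _ => hmeasQ _]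
      refine infH_eq_of_comp P (fun _ => hmeas _) (fun _ => hmeas _)
        (fun x => (e (x.1, erasure x.2), x.2.2))
        (fun y => ((e.symm y.1).1, ((e.symm y.1).2.isSome, y.2)))
        (fun _ => rfl) ?_
      rintro ⟨g, b, s⟩
      cases b <;> simp [U, erasure]
    have hHUZ : infH P (fun ω => (U ω, ω.1 ω.2.2)) ≤ infH P (fun ω => (U ω, ω.2.2)) :=
      infH_le_of_comp P (fun _ => hmeas _) (fun x => (x.1, (e.symm x.1).1 x.2))
        fun ω => by simp [U]
    refine ⟨_, inferInstance, P, inferInstance, fun ω => ω.2.2, fun ω => ω.1 ω.2.2, _, U,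
      measurable_of_finite _, measurable_of_finite _, measurable_of_finite _, hmap, ?_, ?_⟩
    · unfold infMI
      linarith
    · unfold infMI
      linarith
  refine ⟨hex, ?_⟩
  obtain ⟨Ω, mΩ, P, hP, Sv, Zv, n, U, hS, hZ, hU, hmap, hUS, hUZ⟩ := hex
  refine le_csSup_of_le ⟨infH μ Prod.snd, ?_⟩
    ⟨Ω, mΩ, P, hP, Sv, Zv, n, U, hS, hZ, hU, hmap, hUS.le, rfl⟩ hUZ
  rintro _ ⟨Ω, mΩ, P, hP, Sv, Zv, n, U, hS, hZ, hU, hmap, -, rfl⟩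
  rw [← (hmarg P Sv Zv hS hZ hmap).2]
  exact infMI_le_infH P (fun u => hU (measurableSet_singleton u))
    fun z => hZ (measurableSet_singleton z)
end
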